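/- Suppose the subgroup of permutations generated by σ₀ and σ₁ acts transitively on Ω. Then during the full run of the monodromy solving process (with stopping criterion |S| = d), the permutation σ₀ is evaluated exactly d − 1 times and the permutation σ₁ is evaluated exactly j* times, where j* is the largest founder index; in total the process makes exactly d + j* − 1 oracle queries. -/

import Mathlib

/-- State of the monodromy solving process (Algorithm 1): the ordered list `S` of found
solutions, the scan pointer `ptr` (0-based index into `S`), the list `F` of founder
indices (1-based), and the numbers `n0`, `n1` of oracle queries to `σ₀`, `σ₁` so far. -/
structure MonoState (Ω : Type*) where
  S : List Ω
  ptr : ℕ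
  F : List ℕ
  n0 : ℕ
  n1 : ℕ

variable {Ω : Type*} [DecidableEq Ω]

/-- The scan of the inner while-loop: the first index `i ≥ ptr` with `σ₁ S[i] ∉ S`. -/
def monoScan (σ₁ : Equiv.Perm Ω) (S : List Ω) (ptr : ℕ) (dflt : Ω) : Option ℕ :=
  ((List.range S.length).drop ptr).find? fun i => σ₁ (S.getD i dflt) ∉ S

/-- One iteration of the outer while-loop of the monodromy solving process: apply `σ₀` to
the last found solution; if the result is new, append it; otherwise scan with `σ₁` from
the pointer for a new solution (recording the founder index), failing if the scan finds
none. Oracle queries to `σ₀` and `σ₁` are counted by `n0` and `n1`. -/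
def monoStep (σ₀ σ₁ : Equiv.Perm Ω) (dflt : Ω) (st : MonoState Ω) : Option (MonoState Ω) :=
  let q := σ₀ (st.S.getLastD dflt)
  if q ∉ st.S then
    some { st with S := st.S ++ [q], n0 := st.n0 + 1 }
  else
    match monoScan σ₁ st.S st.ptr dflt with
    | none => none
    | some i =>
        some { S := st.S ++ [σ₁ (st.S.getD i dflt)], ptr := i + 1, F := st.F ++ [i + 1],
               n0 := st.n0 + 1, n1 := st.n1 + (i + 1 - st.ptr) }

/-- Running `k` iterations of the monodromy solving process started from the seed
solution `s₁` (so `S = [s₁]`, pointer `1` (0-based `0`), no founder indices, no queries);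
`none` means the process got stuck. -/
def monoRun (σ₀ σ₁ : Equiv.Perm Ω) (s₁ : Ω) (k : ℕ) : Option (MonoState Ω) :=
  (fun o => o.bind (monoStep σ₀ σ₁ s₁))^[k] (some ⟨[s₁], 0, [], 0, 0⟩)

open scoped Pointwise in
/-- A nonempty finite set mapped into itself by every permutation in `A` is everything as soon
as `A` generates a transitive group. -/
theorem Set.Finite.eq_univ_of_mapsTo_of_isPretransitive {α : Type*} {A : Set (Equiv.Perm α)}
    (htrans : MulAction.IsPretransitive (Subgroup.closure A) α) {T : Set α} (hfin : T.Finite)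
    (hne : T.Nonempty) (hmaps : ∀ σ ∈ A, Set.MapsTo σ T T) : T = Set.univ := by
  have hle : Subgroup.closure A ≤ MulAction.stabilizer (Equiv.Perm α) T := by
    refine (Subgroup.closure_le _).2 fun σ hσ => ?_
    exact (MulAction.mem_stabilizer_set_iff_smul_set_subset hfin).2 (hmaps σ hσ).image_subset
  obtain ⟨x, hx⟩ := hne
  refine Set.eq_univ_of_forall fun y => ?_
  obtain ⟨⟨g, hg⟩, rfl⟩ := htrans.exists_smul_eq x y
  exact (MulAction.mem_stabilizer_set.1 (hle hg) x).2 hx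

theorem monoScan_eq_some {σ₁ : Equiv.Perm Ω} {S : List Ω} {ptr : ℕ} {dflt : Ω} {i : ℕ}
    (h : monoScan σ₁ S ptr dflt = some i) :
    ptr ≤ i ∧ i < S.length ∧ σ₁ (S.getD i dflt) ∉ S ∧
      ∀ j, ptr ≤ j → j < i → σ₁ (S.getD j dflt) ∈ S := by
  obtain ⟨hp, k, hk, hki, hlt⟩ := List.find?_eq_some_iff_getElem.1 h
  simp only [List.length_drop, List.length_range, List.getElem_drop, List.getElem_range]
    at hk hki hlt
  refine ⟨by omega, by omega, by simpa using hp, fun j hj hji => ?_⟩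
  have := hlt (j - ptr) (by omega)
  rw [Nat.add_sub_cancel' hj] at this
  simpa using this

theorem monoScan_eq_none {σ₁ : Equiv.Perm Ω} {S : List Ω} {ptr : ℕ} {dflt : Ω}
    (h : monoScan σ₁ S ptr dflt = none) {j : ℕ} (hj : ptr ≤ j) (hjS : j < S.length) :
    σ₁ (S.getD j dflt) ∈ S := by
  have hmem : j ∈ (List.range S.length).drop ptr :=
    List.mem_iff_getElem.2 ⟨j - ptr, by simp; omega, by simp; omega⟩
  simpa using List.find?_eq_none.1 h j hmem

/-- The invariant of the outer while-loop. -/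
structure MonoState.Valid (σ₀ σ₁ : Equiv.Perm Ω) (dflt : Ω) (st : MonoState Ω) : Prop where
  ne_nil : st.S ≠ []
  nodup : st.S.Nodup
  eq_last_or_mem : ∀ x ∈ st.S, x = st.S.getLastD dflt ∨ σ₀ x ∈ st.S
  ptr_le : st.ptr ≤ st.S.length
  scanned : ∀ i < st.ptr, σ₁ (st.S.getD i dflt) ∈ st.S
  n1_eq : st.n1 = st.ptr
  foldr_eq : st.F.foldr max 0 = st.ptr
  n0_eq : st.n0 + 1 = st.S.length

theorem List.foldr_max_append_singleton (l : List ℕ) (a : ℕ) :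
    (l ++ [a]).foldr max 0 = max (l.foldr max 0) a := by
  induction l with
  | nil => simp
  | cons b l ih => simp [-List.foldr_append, ih, max_assoc]

theorem MonoState.Valid.eq_univ_of_monoScan_eq_none {σ₀ σ₁ : Equiv.Perm Ω} {dflt : Ω}
    {st : MonoState Ω} (hv : st.Valid σ₀ σ₁ dflt)
    (htrans : MulAction.IsPretransitive (Subgroup.closure {σ₀, σ₁} : Subgroup (Equiv.Perm Ω)) Ω)
    (hq : σ₀ (st.S.getLastD dflt) ∈ st.S) (hscan : monoScan σ₁ st.S st.ptr dflt = none) :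
    {x | x ∈ st.S} = Set.univ := by
  refine (List.finite_toSet st.S).eq_univ_of_mapsTo_of_isPretransitive htrans
    (List.exists_mem_of_ne_nil _ hv.ne_nil) ?_
  rintro σ (rfl | rfl) x hx
  · rcases hv.eq_last_or_mem x hx with rfl | h
    exacts [hq, h]
  · obtain ⟨j, hj, rfl⟩ := List.mem_iff_getElem.1 hx
    rw [← List.getD_eq_getElem _ dflt hj]
    rcases lt_or_ge j st.ptr with h | h
    exacts [hv.scanned j h, monoScan_eq_none hscan h hj]

theorem MonoState.Valid.exists_monoStep_eq_some [Fintype Ω] {σ₀ σ₁ : Equiv.Perm Ω} {dflt : Ω}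
    {st : MonoState Ω} (hv : st.Valid σ₀ σ₁ dflt)
    (htrans : MulAction.IsPretransitive (Subgroup.closure {σ₀, σ₁} : Subgroup (Equiv.Perm Ω)) Ω)
    (hlt : st.S.length < Fintype.card Ω) :
    ∃ st', monoStep σ₀ σ₁ dflt st = some st' ∧ st'.Valid σ₀ σ₁ dflt ∧ st'.n0 = st.n0 + 1 := by
  have hgetD : ∀ i < st.S.length, ∀ a, (st.S ++ [a]).getD i dflt = st.S.getD i dflt :=
    fun i hi a => List.getD_append _ _ _ _ hi
  by_cases hq : σ₀ (st.S.getLastD dflt) ∈ st.S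
  · cases hscan : monoScan σ₁ st.S st.ptr dflt with
    | none =>
      refine absurd hlt (not_lt.2 ?_)
      rw [← List.toFinset_card_of_nodup hv.nodup, ← Finset.card_univ]
      refine Finset.card_le_card fun x _ => List.mem_toFinset.2 ?_
      exact (hv.eq_univ_of_monoScan_eq_none htrans hq hscan).ge (Set.mem_univ x)
    | some i =>
      obtain ⟨hpi, hiS, hnew, hold⟩ := monoScan_eq_some hscan
      refine ⟨⟨st.S ++ [σ₁ (st.S.getD i dflt)], i + 1, st.F ++ [i + 1], st.n0 + 1,
        st.n1 + (i + 1 - st.ptr)⟩,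
        by simp only [monoStep, hq, hscan, not_true_eq_false, if_false], ?_, rfl⟩
      constructor
      · simp
      · simpa using hv.nodup.concat hnew
      · intro x hx
        rcases List.mem_append.1 hx with hx | hx
        · right
          refine List.mem_append_left _ ?_
          rcases hv.eq_last_or_mem x hx with rfl | h
          exacts [hq, h]
        · left
          simpa using hx
      · simpa using hiS.le
      · intro j hj
        dsimp only at hj ⊢
        rw [hgetD j (by omega)]
        rcases (Nat.lt_succ_iff_lt_or_eq.1 hj) with hj | rfl
        · refine List.mem_append_left _ ?_
          rcases lt_or_ge j st.ptr with h | h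
          exacts [hv.scanned j h, hold j h hj]
        · simp
      · have := hv.n1_eq
        dsimp only
        omega
      · dsimp only
        rw [List.foldr_max_append_singleton, hv.foldr_eq]
        omega
      · simpa using hv.n0_eq
  · refine ⟨⟨st.S ++ [σ₀ (st.S.getLastD dflt)], st.ptr, st.F, st.n0 + 1, st.n1⟩,
      by simp only [monoStep, hq, not_false_eq_true, if_true], ?_, rfl⟩
    constructor
    · simp
    · simpa using hv.nodup.concat hq
    · intro x hx
      rcases List.mem_append.1 hx with hx | hx
      · right
        rcases hv.eq_last_or_mem x hx with rfl | h
        exacts [List.mem_append_right _ (by simp), List.mem_append_left _ h]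
      · left
        simpa using hx
    · simpa using hv.ptr_le.trans (Nat.le_succ _)
    · intro j hj
      have := hv.ptr_le
      dsimp only at hj ⊢
      rw [hgetD j (by omega)]
      exact List.mem_append_left _ (hv.scanned j hj)
    · exact hv.n1_eq
    · exact hv.foldr_eq
    · simpa using hv.n0_eq

theorem exists_monoRun_eq_some [Fintype Ω] {σ₀ σ₁ : Equiv.Perm Ω} (s₁ : Ω)
    (htrans : MulAction.IsPretransitive (Subgroup.closure {σ₀, σ₁} : Subgroup (Equiv.Perm Ω)) Ω)
    {k : ℕ} (hk : k < Fintype.card Ω) :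
    ∃ st, monoRun σ₀ σ₁ s₁ k = some st ∧ st.Valid σ₀ σ₁ s₁ ∧ st.n0 = k := by
  induction k with
  | zero => exact ⟨_, rfl, by constructor <;> simp, rfl⟩
  | succ k ih =>
    obtain ⟨st, hrun, hv, hn0⟩ := ih (by omega)
    have hlen := hv.n0_eq
    obtain ⟨st', hstep, hv', hn0'⟩ := hv.exists_monoStep_eq_some htrans (by omega)
    refine ⟨st', ?_, hv', by omega⟩
    rw [monoRun, Function.iterate_succ_apply', ← monoRun, hrun, Option.bind_some, hstep]

/-- If `⟨σ₀,σ₁⟩` acts transitively on `Ω` with `|Ω| = d ≥ 1`, then during the full run of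
the monodromy solving process, `σ₀` is evaluated exactly `d − 1` times and `σ₁` is
evaluated exactly `j*` times, where `j*` is the largest founder index (`0` if there are
none); in total, exactly `d + j* − 1` oracle queries are made. -/
theorem monodromySolve_query_count {Ω : Type*} [Fintype Ω] [DecidableEq Ω]
    (σ₀ σ₁ : Equiv.Perm Ω) (s₁ : Ω) (hd : 1 ≤ Fintype.card Ω)
    (htrans : MulAction.IsPretransitive (Subgroup.closure {σ₀, σ₁} : Subgroup (Equiv.Perm Ω)) Ω) :
    ∃ final : MonoState Ω, monoRun σ₀ σ₁ s₁ (Fintype.card Ω - 1) = some final ∧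
      final.n0 = Fintype.card Ω - 1 ∧
      final.n1 = final.F.foldr max 0 ∧
      final.n0 + final.n1 = Fintype.card Ω + final.F.foldr max 0 - 1 := by
  obtain ⟨st, hrun, hv, hn0⟩ :=
    exists_monoRun_eq_some s₁ htrans (k := Fintype.card Ω - 1) (by omega)
  have hn1 := hv.n1_eq
  have hF := hv.foldr_eq
  exact ⟨st, hrun, hn0, by omega, by omega⟩
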